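/- arXiv:1910.09416 — 3 statements merged into one kernel-verified Lean document; each statement's English description precedes it below -/
import Mathlib

section
/- Fix a real number a with 0 < a ≤ 1/2 and a fixed odd integer m ≥ 3. Then the limit as n → ∞ of Φ̄_m(n;a) exists and equals 1/(2a) − 1. -/
/-- Generalized binomial coefficient `C(y,j) = y(y-1)⋯(y-j+1)/j!`. -/
noncomputable def genChoose (y : ℝ) (j : ℕ) : ℝ :=
  (∏ i ∈ Finset.range j, (y - i)) / (Nat.factorial j)

/-- The Krawtchouk polynomial `K_k^{(n)}(x)`. -/
noncomputable def kraw (n k : ℕ) (x : ℝ) : ℝ :=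
  ∑ j ∈ Finset.range (k + 1), (-1 : ℝ) ^ j * genChoose x j * genChoose ((n : ℝ) - x) (k - j)

/-- The value `Φ̄_m(n;a)` of the dual linear program for the degree-`m` Fourier weight. -/
noncomputable def PhiBar (m n : ℕ) (a : ℝ) : ℝ :=
  sSup {v : ℝ | ∃ x : ℕ → ℝ,
    (∀ k ∈ Finset.Icc 1 n, 0 ≤ x k) ∧
    (∀ i ∈ Finset.Icc 1 n, i ≠ m →
      -1 ≤ ∑ k ∈ Finset.Icc 1 n, (kraw n k (m : ℝ) - kraw n k (i : ℝ)) * x k) ∧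
    v = -∑ k ∈ Finset.Icc 1 n, (kraw n k 0 + (1 / a - 1) * kraw n k (m : ℝ)) * x k}

/-- The Krawtchouk numbers `∑ (-1)^j C(i,j) C(r,k-j)`, the coefficients of `(1-z)^i (1+z)^r`. -/
def krawNat (i r k : ℕ) : ℝ :=
  ∑ j ∈ Finset.range (k + 1), (-1 : ℝ) ^ j * (i.choose j : ℝ) * (r.choose (k - j) : ℝ)

lemma genChoose_natCast (n j : ℕ) : genChoose n j = (n.choose j : ℝ) := by
  rw [Nat.cast_choose_eq_descPochhammer_div, descPochhammer_eval_eq_prod_range, genChoose]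

lemma kraw_natCast_add (i r k : ℕ) : kraw (i + r) k (i : ℝ) = krawNat i r k := by
  have h : ((i + r : ℕ) : ℝ) - i = (r : ℕ) := by push_cast; ring
  simp only [kraw, krawNat, h, genChoose_natCast]

lemma krawNat_zero_left (r k : ℕ) : krawNat 0 r k = (r.choose k : ℝ) := by
  simp [krawNat, Finset.sum_range_succ']

lemma krawNat_zero_right (i r : ℕ) : krawNat i r 0 = 1 := by
  simp [krawNat]

lemma krawNat_succ_succ (i r k : ℕ) :
    krawNat (i + 1) r (k + 1) = krawNat i r (k + 1) - krawNat i r k := by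
  unfold krawNat
  rw [Finset.sum_range_succ' _ (k + 1), Finset.sum_range_succ' _ (k + 1), add_sub_right_comm,
    ← Finset.sum_sub_distrib]
  congr 1
  · refine Finset.sum_congr rfl fun j _ => ?_
    rw [Nat.choose_succ_succ, Nat.add_sub_add_right]
    push_cast
    ring
  · simp

lemma krawNat_eq_zero {i r k : ℕ} (h : i + r < k) : krawNat i r k = 0 := by
  refine Finset.sum_eq_zero fun j _ => ?_
  rcases lt_or_ge i j with hj | hj
  · simp [Nat.choose_eq_zero_of_lt hj]
  · simp [Nat.choose_eq_zero_of_lt (show r < k - j by omega)]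

lemma krawNat_top (i r : ℕ) : krawNat i r (i + r) = (-1) ^ i := by
  induction i with
  | zero => simp [krawNat_zero_left]
  | succ i ih =>
    rw [show i + 1 + r = i + r + 1 by ring, krawNat_succ_succ, ih,
      krawNat_eq_zero (Nat.lt_succ_self _), pow_succ]
    ring

lemma abs_one_sub_two_mul_le {p : ℝ} (h0 : 0 ≤ p) (h1 : p ≤ 1) : |1 - 2 * p| ≤ 1 := by
  rw [abs_le]; constructor <;> linarith

lemma abs_pow_sub_pow_le_of_abs_le_one {s t d : ℝ} (i : ℕ) (hs : |s| ≤ 1) (ht : |t| ≤ 1)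
    (h : |s - t| ≤ d) : |s ^ i - t ^ i| ≤ d * i := by
  refine (abs_pow_sub_pow_le s t i).trans ?_
  have hmax : max |s| |t| ^ (i - 1) ≤ 1 :=
    pow_le_one₀ (le_max_of_le_left (abs_nonneg s)) (max_le hs ht)
  calc |s - t| * i * max |s| |t| ^ (i - 1) ≤ |s - t| * i * 1 := by gcongr
    _ ≤ d * i := by rw [mul_one]; gcongr

/-- Normalized Krawtchouk numbers are within `O(1/n)` of the powers of `1 - 2k/n`, uniformly
in `k`. -/
lemma exists_abs_krawNat_sub_le (i : ℕ) : ∃ C : ℝ, 0 ≤ C ∧ ∀ r k : ℕ, 1 ≤ r →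
    |krawNat i r k - (1 - 2 * ((k : ℝ) / (i + r : ℕ))) ^ i * ((i + r).choose k : ℝ)|
      ≤ C / (i + r : ℕ) * ((i + r).choose k : ℝ) := by
  induction i with
  | zero => exact ⟨0, le_rfl, fun r k _ => by simp [krawNat_zero_left]⟩
  | succ i ih =>
    obtain ⟨C, hC, H⟩ := ih
    refine ⟨2 * C + 2 * i, by positivity, fun r k hr => ?_⟩
    rw [show i + 1 + r = i + r + 1 by ring]
    have hN : 1 ≤ i + r := by omega
    have H1 := fun k => H r k hr
    generalize hn : i + r = n at H1 hN ⊢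
    have hn0 : (1 : ℝ) ≤ n := by exact_mod_cast hN
    rcases k with _ | k
    · simp only [krawNat_zero_right, Nat.choose_zero_right]
      norm_num
      positivity
    rcases lt_or_ge n k with hk | hk
    · rw [krawNat_eq_zero (by omega), Nat.choose_eq_zero_of_lt (by omega)]
      simp
    have hkn : (k : ℝ) ≤ n := by exact_mod_cast hk
    set p : ℝ := ((k + 1 : ℕ) : ℝ) / (n + 1 : ℕ) with hp
    have hp0 : 0 ≤ p := by positivity
    have hp1 : p ≤ 1 := by
      rw [hp, div_le_one (by positivity)]; push_cast; linarith
    have ht := abs_one_sub_two_mul_le hp0 hp1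
    have hc0 : (n.choose k : ℝ) = p * ((n + 1).choose (k + 1) : ℝ) := by
      have := Nat.add_one_mul_choose_eq n k
      have h2 : ((n : ℝ) + 1) * n.choose k = (n + 1).choose (k + 1) * ((k : ℝ) + 1) := by
        exact_mod_cast this
      rw [hp]; push_cast; field_simp; linarith
    have hc : ((n + 1).choose (k + 1) : ℝ) = n.choose k + n.choose (k + 1) := by
      exact_mod_cast Nat.choose_succ_succ n k
    have E0 : |(1 - 2 * ((k : ℝ) / n)) ^ i - (1 - 2 * p) ^ i| ≤ 2 / (n + 1 : ℕ) * i := by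
      refine abs_pow_sub_pow_le_of_abs_le_one i (abs_one_sub_two_mul_le (by positivity)
        (by rw [div_le_one (by positivity)]; exact hkn)) ht ?_
      have : 1 - 2 * ((k : ℝ) / n) - (1 - 2 * p) = 2 / (n + 1 : ℕ) * ((n - k) / n) := by
        rw [hp]; push_cast; field_simp; ring
      rw [this, abs_of_nonneg (mul_nonneg (by positivity) (div_nonneg (by linarith) (by positivity)))]
      refine mul_le_of_le_one_right (by positivity) ?_
      rw [div_le_one (by positivity)]
      linarith [Nat.cast_nonneg (α := ℝ) k]
    have E1 : |(1 - 2 * (((k + 1 : ℕ) : ℝ) / n)) ^ i - (1 - 2 * p) ^ i| * n.choose (k + 1)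
        ≤ 2 / (n + 1 : ℕ) * i * n.choose (k + 1) := by
      rcases hk.eq_or_lt with h | h
      · simp [h]
      have hkn' : ((k + 1 : ℕ) : ℝ) ≤ n := by exact_mod_cast h
      refine mul_le_mul_of_nonneg_right ?_ (by positivity)
      refine abs_pow_sub_pow_le_of_abs_le_one i (abs_one_sub_two_mul_le (by positivity)
        (by rw [div_le_one (by positivity)]; exact hkn')) ht ?_
      have : 1 - 2 * (((k + 1 : ℕ) : ℝ) / n) - (1 - 2 * p)
          = -(2 / (n + 1 : ℕ) * (((k + 1 : ℕ) : ℝ) / n)) := by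
        rw [hp]; push_cast; field_simp; ring
      rw [this, abs_neg, abs_of_nonneg (by positivity)]
      refine mul_le_of_le_one_right (by positivity) ?_
      rw [div_le_one (by positivity)]
      exact hkn'
    have hCn : C / n ≤ 2 * C / (n + 1 : ℕ) := by
      rw [div_le_div_iff₀ (by positivity) (by positivity)]
      push_cast
      nlinarith
    have split : krawNat (i + 1) r (k + 1) - (1 - 2 * p) ^ (i + 1) * (n + 1).choose (k + 1)
        = (krawNat i r (k + 1)
              - (1 - 2 * (((k + 1 : ℕ) : ℝ) / n)) ^ i * n.choose (k + 1))
          + ((1 - 2 * (((k + 1 : ℕ) : ℝ) / n)) ^ i - (1 - 2 * p) ^ i) * n.choose (k + 1)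
          - ((krawNat i r k - (1 - 2 * ((k : ℝ) / n)) ^ i * n.choose k)
          + ((1 - 2 * ((k : ℝ) / n)) ^ i - (1 - 2 * p) ^ i) * n.choose k) := by
      rw [krawNat_succ_succ, pow_succ]
      linear_combination (1 - 2 * p) ^ i * (-hc - 2 * hc0)
    rw [split]
    refine (abs_sub _ _).trans ((add_le_add (abs_add_le _ _) (abs_add_le _ _)).trans ?_)
    rw [abs_mul, abs_mul, Nat.abs_cast, Nat.abs_cast]
    have F0 := mul_le_mul_of_nonneg_right E0 (Nat.cast_nonneg (α := ℝ) (n.choose k))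
    have F1 := H1 (k + 1)
    have F2 := H1 k
    have G1 := mul_le_mul_of_nonneg_right hCn (Nat.cast_nonneg (α := ℝ) (n.choose k))
    have G2 := mul_le_mul_of_nonneg_right hCn (Nat.cast_nonneg (α := ℝ) (n.choose (k + 1)))
    have : (2 * C + 2 * i) / (n + 1 : ℕ) * ((n + 1).choose (k + 1) : ℝ)
        = 2 * C / (n + 1 : ℕ) * n.choose k + 2 * C / (n + 1 : ℕ) * n.choose (k + 1)
          + 2 / (n + 1 : ℕ) * i * n.choose k + 2 / (n + 1 : ℕ) * i * n.choose (k + 1) := by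
      rw [hc]; ring
    linarith

lemma kraw_natCast_of_le {i n : ℕ} (h : i ≤ n) (k : ℕ) : kraw n k (i : ℝ) = krawNat i (n - i) k := by
  obtain ⟨r, rfl⟩ := Nat.exists_eq_add_of_le h
  rw [Nat.add_sub_cancel_left, kraw_natCast_add]

lemma kraw_self {i n : ℕ} (h : i ≤ n) : kraw n n (i : ℝ) = (-1) ^ i := by
  rw [kraw_natCast_of_le h]
  have := krawNat_top i (n - i)
  rwa [Nat.add_sub_of_le h] at this

lemma kraw_zero (n k : ℕ) : kraw n k 0 = (n.choose k : ℝ) := by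
  simpa [krawNat_zero_left] using kraw_natCast_of_le (Nat.zero_le n) k

lemma eventually_abs_kraw_sub_le (i : ℕ) {δ : ℝ} (hδ : 0 < δ) :
    ∀ᶠ n : ℕ in Filter.atTop, ∀ k : ℕ,
      |kraw n k (i : ℝ) - (1 - 2 * ((k : ℝ) / n)) ^ i * (n.choose k : ℝ)|
        ≤ δ * (n.choose k : ℝ) := by
  obtain ⟨C, -, H⟩ := exists_abs_krawNat_sub_le i
  filter_upwards [Filter.eventually_gt_atTop i,
    (tendsto_const_div_atTop_nhds_zero_nat C).eventually_le_const hδ] with n hn hC k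
  have h := H (n - i) k (by omega)
  rw [Nat.add_sub_of_le hn.le] at h
  rw [kraw_natCast_of_le hn.le]
  exact h.trans (by gcongr)

lemma le_one_add_mul_pow_add {b ε t : ℝ} (l : ℕ) (hb : 1 ≤ b) (hε : 0 < ε) (hε2 : ε ≤ 1 / 2)
    (ht : |t| ≤ 1) :
    2 * ε ≤ 1 + (b - ((b - 1) / 2 + ε)) * t ^ (2 * l + 1) + ((b - 1) / 2 + ε) * t ^ (2 * l) := by
  have h0 : 0 ≤ t ^ (2 * l) := (even_two_mul l).pow_nonneg t
  have h1 : t ^ (2 * l) ≤ 1 := by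
    rw [← (even_two_mul l).pow_abs]; exact pow_le_one₀ (abs_nonneg t) ht
  have h2 : 2 * ε - 1 ≤ (b - ((b - 1) / 2 + ε)) * t + ((b - 1) / 2 + ε) := by
    nlinarith [(abs_le.1 ht).1]
  rw [pow_succ]
  nlinarith [mul_le_mul_of_nonneg_right h2 h0]

/-- Dual feasibility, for large `n`, of the solution supported on the single weight `2l`. -/
lemma eventually_dual_feasible {b ε : ℝ} (l : ℕ) (hb : 1 ≤ b) (hε : 0 < ε) (hε2 : ε ≤ 1 / 2) :
    ∀ᶠ n : ℕ in Filter.atTop, ∀ k ∈ Finset.Icc 1 n,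
      0 ≤ kraw n k 0 + b * kraw n k ((2 * l + 1 : ℕ) : ℝ)
        - ((b - 1) / 2 + ε) * (kraw n k ((2 * l + 1 : ℕ) : ℝ) - kraw n k ((2 * l : ℕ) : ℝ)) := by
  set w := (b - 1) / 2 + ε with hw
  have hw0 : 0 ≤ w := by linarith
  have hbw : 0 ≤ b - w := by linarith
  have hδ : 0 < ε / b := by positivity
  filter_upwards [eventually_abs_kraw_sub_le (2 * l) hδ,
    eventually_abs_kraw_sub_le (2 * l + 1) hδ] with n h0 h1 k hk
  rw [Finset.mem_Icc] at hk
  have hn : (0 : ℝ) < n := by exact_mod_cast hk.1.trans hk.2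
  have ht : |1 - 2 * ((k : ℝ) / n)| ≤ 1 := abs_one_sub_two_mul_le (by positivity)
    (by rw [div_le_one hn]; exact_mod_cast hk.2)
  have hg := le_one_add_mul_pow_add l hb hε hε2 ht
  rw [← hw] at hg
  have e0 := mul_le_mul_of_nonneg_left (abs_le.1 (h0 k)).1 hw0
  have e1 := mul_le_mul_of_nonneg_left (abs_le.1 (h1 k)).1 hbw
  have hc := mul_le_mul_of_nonneg_right hg (Nat.cast_nonneg (α := ℝ) (n.choose k))
  have hbb : b * (ε / b * (n.choose k : ℝ)) = ε * n.choose k := by field_simp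
  have hpos : 0 ≤ ε * (n.choose k : ℝ) := by positivity
  rw [kraw_zero]
  linarith

/-- The set of objective values of feasible points of the linear program defining `PhiBar`. -/
def phiBarValues (m n : ℕ) (a : ℝ) : Set ℝ :=
  {v : ℝ | ∃ x : ℕ → ℝ,
    (∀ k ∈ Finset.Icc 1 n, 0 ≤ x k) ∧
    (∀ i ∈ Finset.Icc 1 n, i ≠ m →
      -1 ≤ ∑ k ∈ Finset.Icc 1 n, (kraw n k (m : ℝ) - kraw n k (i : ℝ)) * x k) ∧
    v = -∑ k ∈ Finset.Icc 1 n, (kraw n k 0 + (1 / a - 1) * kraw n k (m : ℝ)) * x k}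

/-- Weak duality for a dual solution supported on a single index `i`. -/
lemma mem_upperBounds_phiBarValues {m n i : ℕ} {a w : ℝ} (hw : 0 ≤ w) (hi : i ∈ Finset.Icc 1 n)
    (him : i ≠ m)
    (h : ∀ k ∈ Finset.Icc 1 n, 0 ≤ kraw n k 0 + (1 / a - 1) * kraw n k (m : ℝ)
      - w * (kraw n k (m : ℝ) - kraw n k (i : ℝ))) :
    w ∈ upperBounds (phiBarValues m n a) := by
  rintro _ ⟨x, hx, hc, rfl⟩
  have h1 := mul_le_mul_of_nonneg_left (hc i hi him) hw
  have h2 := Finset.sum_nonneg fun k hk => mul_nonneg (h k hk) (hx k hk)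
  simp only [sub_mul _ (w * _), mul_assoc w, Finset.sum_sub_distrib, ← Finset.mul_sum] at h2
  linarith

/-- The feasible point `x = (0, …, 0, 1/2)` and its value. -/
lemma half_mem_phiBarValues (a : ℝ) (l : ℕ) {n : ℕ} (hn : 2 * l + 1 ≤ n) :
    (1 / a - 1 - 1) / 2 ∈ phiBarValues (2 * l + 1) n a := by
  have hsum : ∀ f : ℕ → ℝ,
      ∑ k ∈ Finset.Icc 1 n, f k * (if k = n then 1 / 2 else 0) = f n / 2 := by
    intro f
    rw [Finset.sum_eq_single_of_mem n (Finset.mem_Icc.2 ⟨by omega, le_rfl⟩)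
      fun k _ hk => by simp [hk]]
    simp [div_eq_mul_inv]
  have hodd : ((-1 : ℝ)) ^ (2 * l + 1) = -1 := (odd_two_mul_add_one l).neg_one_pow
  refine ⟨fun k => if k = n then 1 / 2 else 0, fun k _ => by positivity, fun i hi _ => ?_, ?_⟩
  · rw [hsum fun k => kraw n k ((2 * l + 1 : ℕ) : ℝ) - kraw n k (i : ℝ), kraw_self hn,
      kraw_self (Finset.mem_Icc.1 hi).2, hodd]
    rcases neg_one_pow_eq_or ℝ i with h | h <;> rw [h] <;> norm_num
  · rw [hsum fun k => kraw n k 0 + (1 / a - 1) * kraw n k ((2 * l + 1 : ℕ) : ℝ), kraw_self hn,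
      kraw_zero, hodd, Nat.choose_self]
    push_cast
    ring

theorem phiBar_tendsto_odd (a : ℝ) (ha0 : 0 < a) (ha : a ≤ 1 / 2)
    (m : ℕ) (hm : Odd m) (hm3 : 3 ≤ m) :
    Filter.Tendsto (fun n : ℕ => PhiBar m n a) Filter.atTop (nhds (1 / (2 * a) - 1)) := by
  obtain ⟨l, rfl⟩ := hm
  have hb1 : 1 ≤ 1 / a - 1 := by
    have : 2 ≤ 1 / a := by rw [le_div_iff₀ ha0]; linarith
    linarith
  have hlim : 1 / (2 * a) - 1 = (1 / a - 1 - 1) / 2 := by field_simp; ring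
  rw [hlim, Metric.tendsto_nhds]
  intro ε hε
  have hε' : 0 < min (ε / 2) (1 / 2) := by positivity
  filter_upwards [eventually_dual_feasible l hb1 hε' (min_le_right _ _),
    Filter.eventually_ge_atTop (2 * l + 1)] with n hn hln
  have hub := mem_upperBounds_phiBarValues (by linarith) (Finset.mem_Icc.2 ⟨by omega, by omega⟩)
    (by omega) hn
  have hmem := half_mem_phiBarValues a l hln
  have h1 : _ ≤ PhiBar (2 * l + 1) n a := le_csSup ⟨_, hub⟩ hmem
  have h2 : PhiBar (2 * l + 1) n a ≤ _ := csSup_le ⟨_, hmem⟩ hub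
  rw [Real.dist_eq, abs_lt]
  constructor <;> linarith [min_le_left (ε / 2) (1 / 2)]
end

section
/- Let f: {-1,1}^n → {-1,1} be a Boolean function with a := |f^{-1}(1)|/2^n satisfying 0 < a ≤ 1/2, and let ρ ∈ [0,1]. Then θ⁻(a) ≤ q ≤ θ⁺(a), where θ⁺(a) := min{ a, a² + 2a²η(a)ρ + (a(1−a) − 2a²η(a))ρ² } and θ⁻(a) := max{ 0, a² − 2a²η(a)ρ − (a(1−a) − 2a²η(a))ρ² }. -/
/-- The Boolean cube `{-1,1}^n` as a finset of functions `Fin n → ℤ`. -/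
def cube (n : ℕ) : Finset (Fin n → ℤ) :=
  Fintype.piFinset fun _ => ({-1, 1} : Finset ℤ)

/-- The density `a = |f⁻¹(1)|/2^n` of the Boolean function `f`. -/
noncomputable def density (n : ℕ) (f : (Fin n → ℤ) → ℤ) : ℝ :=
  (((cube n).filter fun x => f x = 1).card : ℝ) / 2 ^ n

/-- `q = P(f(X) = 1 ∧ f(Y) = 1)`, where the coordinate pairs `(X_i, Y_i)` are i.i.d.
with joint distribution `P(x,y) = (1 + ρxy)/4` on `{-1,1}²`. -/
noncomputable def qProb (n : ℕ) (f : (Fin n → ℤ) → ℤ) (ρ : ℝ) : ℝ :=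
  ∑ x ∈ cube n, ∑ y ∈ cube n,
    if f x = 1 ∧ f y = 1 then ∏ i, (1 + ρ * (x i : ℝ) * (y i : ℝ)) / 4 else 0

/-- `φ(a) = 1/√a − 1` for `0 < a ≤ 1/4` and `φ(a) = 1/(4a)` for `1/4 < a ≤ 1/2`. -/
noncomputable def phi (a : ℝ) : ℝ :=
  if a ≤ 1 / 4 then 1 / Real.sqrt a - 1 else 1 / (4 * a)

/-- The hypercontractivity quantity `ψ(a)`. -/
noncomputable def psi (a : ℝ) : ℝ :=
  sInf {v : ℝ | ∃ t : ℝ, 0 < t ∧ t ≠ 1 ∧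
    v = (t * a + 1 - a) *
        (a * t * Real.log t - (t * a + 1 - a) * Real.log (t * a + 1 - a)) /
        (a ^ 2 * (t - 1) ^ 2)}

/-- `η(a) = min{φ(a), ψ(a)}`. -/
noncomputable def eta (a : ℝ) : ℝ := min (phi a) (psi a)

open Finset

/-- The set `f⁻¹(1)`, as a finset of points of the cube. -/
def preimageOne (n : ℕ) (f : (Fin n → ℤ) → ℤ) : Finset (Fin n → ℤ) :=
  (cube n).filter fun x => f x = 1

/-- The Fourier coefficient at `S` of the indicator function of `f⁻¹(1)`. -/
noncomputable def walshCoeff (n : ℕ) (f : (Fin n → ℤ) → ℤ) (S : Finset (Fin n)) : ℝ :=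
  (∑ x ∈ preimageOne n f, ∏ i ∈ S, (x i : ℝ)) / 2 ^ n

/-- The level-one Fourier weight of the indicator function of `f⁻¹(1)`. -/
noncomputable def weightOne (n : ℕ) (f : (Fin n → ℤ) → ℤ) : ℝ :=
  ∑ i, walshCoeff n f {i} ^ 2

lemma mem_cube {n : ℕ} {x : Fin n → ℤ} : x ∈ cube n ↔ ∀ i, x i = -1 ∨ x i = 1 := by
  simp [cube]

lemma card_cube (n : ℕ) : ((cube n).card : ℝ) = 2 ^ n := by
  simp [cube]

lemma card_preimageOne (n : ℕ) (f : (Fin n → ℤ) → ℤ) :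
    ((preimageOne n f).card : ℝ) = density n f * 2 ^ n := by
  rw [density, preimageOne]
  field_simp

lemma walshCoeff_empty (n : ℕ) (f : (Fin n → ℤ) → ℤ) :
    walshCoeff n f ∅ = density n f := by
  simp [walshCoeff, density, preimageOne]

lemma qProb_eq_sum_preimageOne (n : ℕ) (f : (Fin n → ℤ) → ℤ) (ρ : ℝ) :
    qProb n f ρ = ∑ x ∈ preimageOne n f, ∑ y ∈ preimageOne n f,
      ∏ i, (1 + ρ * (x i : ℝ) * (y i : ℝ)) / 4 := by
  simp only [qProb, preimageOne, sum_filter]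
  refine sum_congr rfl fun x _ => ?_
  split_ifs with h <;> simp [h]

lemma prod_kernel_eq_sum (n : ℕ) (x y : Fin n → ℤ) (ρ : ℝ) :
    ∏ i, (1 + ρ * (x i : ℝ) * (y i : ℝ)) / 4 =
      ∑ S : Finset (Fin n), ρ ^ S.card *
        ((∏ i ∈ S, (x i : ℝ)) / 2 ^ n * ((∏ i ∈ S, (y i : ℝ)) / 2 ^ n)) := by
  rw [prod_div_distrib, prod_one_add, sum_div, powerset_univ]
  refine sum_congr rfl fun S _ => ?_
  rw [prod_mul_distrib, prod_mul_distrib, prod_const, prod_const, card_univ, Fintype.card_fin,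
    show (4 : ℝ) = 2 * 2 by norm_num, mul_pow]
  field_simp

lemma qProb_eq_sum_walshCoeff (n : ℕ) (f : (Fin n → ℤ) → ℤ) (ρ : ℝ) :
    qProb n f ρ = ∑ S : Finset (Fin n), ρ ^ S.card * walshCoeff n f S ^ 2 := by
  simp_rw [qProb_eq_sum_preimageOne, prod_kernel_eq_sum]
  rw [sum_congr rfl fun x _ => sum_comm, sum_comm]
  refine sum_congr rfl fun S _ => ?_
  simp_rw [← mul_sum]
  rw [← sum_mul, ← sum_div, sq, walshCoeff]

lemma qProb_nonneg (n : ℕ) (f : (Fin n → ℤ) → ℤ) {ρ : ℝ} (h : |ρ| ≤ 1) :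
    0 ≤ qProb n f ρ := by
  rw [qProb_eq_sum_preimageOne]
  refine sum_nonneg fun x hx => sum_nonneg fun y hy => prod_nonneg fun i _ => ?_
  obtain ⟨h1, h2⟩ := abs_le.1 h
  rcases mem_cube.1 (mem_filter.1 hx).1 i with hi | hi <;>
    rcases mem_cube.1 (mem_filter.1 hy).1 i with hj | hj <;>
    · rw [hi, hj]
      push_cast
      linarith

lemma qProb_one (n : ℕ) (f : (Fin n → ℤ) → ℤ) : qProb n f 1 = density n f := by
  have key : ∀ x ∈ preimageOne n f, ∀ y ∈ preimageOne n f,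
      ∏ i, (1 + 1 * (x i : ℝ) * (y i : ℝ)) / 4 = if x = y then 1 / 2 ^ n else 0 := by
    intro x hx y hy
    have hx := mem_cube.1 (mem_filter.1 hx).1
    have hy := mem_cube.1 (mem_filter.1 hy).1
    split_ifs with h
    · subst h
      have : ∀ i, (1 + 1 * (x i : ℝ) * (x i : ℝ)) / 4 = 1 / 2 := fun i => by
        rcases hx i with hi | hi <;> rw [hi] <;> norm_num
      rw [prod_congr rfl fun i _ => this i]
      simp
    · obtain ⟨i, hi⟩ := Function.ne_iff.1 h
      refine prod_eq_zero (mem_univ i) ?_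
      rcases hx i with h1 | h1 <;> rcases hy i with h2 | h2 <;> rw [h1, h2] at hi ⊢ <;>
        first | exact absurd rfl hi | norm_num
  rw [qProb_eq_sum_preimageOne, sum_congr rfl fun x hx => sum_congr rfl (key x hx)]
  rw [sum_congr rfl fun x hx => by rw [sum_ite_eq, if_pos hx]]
  rw [sum_const, nsmul_eq_mul, card_preimageOne]
  field_simp

lemma weightOne_nonneg (n : ℕ) (f : (Fin n → ℤ) → ℤ) : 0 ≤ weightOne n f :=
  sum_nonneg fun _ _ => sq_nonneg _

lemma weightOne_eq_sum_ite (n : ℕ) (f : (Fin n → ℤ) → ℤ) :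
    weightOne n f =
      ∑ S : Finset (Fin n), if S.card = 1 then walshCoeff n f S ^ 2 else 0 := by
  rw [← sum_filter, ← powerset_univ, ← powersetCard_eq_filter, powersetCard_one, sum_map]
  rfl

/-- All the Fourier weight above level one is at most `ρ ^ 2` times its undamped value. -/
lemma qProb_le (n : ℕ) (f : (Fin n → ℤ) → ℤ) {ρ : ℝ} (h : |ρ| ≤ 1) :
    qProb n f ρ ≤ density n f ^ 2 + weightOne n f * ρ +
      (density n f * (1 - density n f) - weightOne n f) * ρ ^ 2 := by
  have h0 : density n f ^ 2 =
      ∑ S : Finset (Fin n), if S = ∅ then walshCoeff n f S ^ 2 else 0 := by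
    simp [walshCoeff_empty]
  have h1 : density n f = ∑ S : Finset (Fin n), walshCoeff n f S ^ 2 := by
    rw [← qProb_one, qProb_eq_sum_walshCoeff]
    simp
  have h2 : density n f ^ 2 + weightOne n f * ρ +
      (density n f * (1 - density n f) - weightOne n f) * ρ ^ 2 =
      density n f ^ 2 + weightOne n f * ρ +
        (density n f - density n f ^ 2 - weightOne n f) * ρ ^ 2 := by ring
  rw [h2, qProb_eq_sum_walshCoeff, h0, weightOne_eq_sum_ite, h1,
    ← sum_sub_distrib, ← sum_sub_distrib, sum_mul, sum_mul,
    ← sum_add_distrib, ← sum_add_distrib]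
  refine sum_le_sum fun S _ => ?_
  by_cases hS0 : S = ∅
  · simp [hS0]
  by_cases hS1 : S.card = 1
  · simp [hS0, hS1, mul_comm]
  have hS2 : 2 ≤ S.card := by
    have := card_pos.2 (nonempty_iff_ne_empty.2 hS0)
    omega
  have hpow : ρ ^ S.card ≤ ρ ^ 2 := by
    calc ρ ^ S.card ≤ |ρ| ^ S.card := by rw [← abs_pow]; exact le_abs_self _
      _ ≤ |ρ| ^ 2 := pow_le_pow_of_le_one (abs_nonneg _) h hS2
      _ = ρ ^ 2 := sq_abs ρ
  simp only [hS0, hS1, if_false]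
  nlinarith [mul_le_mul_of_nonneg_right hpow (sq_nonneg (walshCoeff n f S))]

lemma sq_density_le_qProb (n : ℕ) (f : (Fin n → ℤ) → ℤ) {ρ : ℝ} (h : 0 ≤ ρ) :
    density n f ^ 2 ≤ qProb n f ρ := by
  rw [qProb_eq_sum_walshCoeff, ← walshCoeff_empty]
  have := single_le_sum (f := fun S : Finset (Fin n) => ρ ^ S.card * walshCoeff n f S ^ 2)
    (fun S _ => by positivity) (mem_univ ∅)
  simpa using this

lemma qProb_le_density (n : ℕ) (f : (Fin n → ℤ) → ℤ) {ρ : ℝ} (h0 : 0 ≤ ρ) (h1 : ρ ≤ 1) :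
    qProb n f ρ ≤ density n f := by
  rw [← qProb_one, qProb_eq_sum_walshCoeff, qProb_eq_sum_walshCoeff]
  gcongr

/-- The linear programming bound on the level-one weight, from nonnegativity of the
stability at the negative correlation `-√a / (1 - √a)` or `-1`. -/
lemma weightOne_le_phi (n : ℕ) (f : (Fin n → ℤ) → ℤ) (ha0 : 0 < density n f) :
    weightOne n f ≤ 2 * density n f ^ 2 * phi (density n f) := by
  have key : ∀ r : ℝ, 0 ≤ r → r ≤ 1 → weightOne n f * (r * (1 + r)) ≤
      density n f ^ 2 + (density n f * (1 - density n f)) * r ^ 2 := by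
    intro r hr0 hr1
    have habs : |-r| ≤ 1 := by rwa [abs_neg, abs_of_nonneg hr0]
    nlinarith [(qProb_nonneg n f habs).trans (qProb_le n f habs)]
  generalize density n f = a at *
  generalize weightOne n f = w at *
  unfold phi
  split_ifs with h
  · obtain ⟨s, hs0, rfl⟩ : ∃ s : ℝ, 0 < s ∧ a = s ^ 2 :=
      ⟨√a, Real.sqrt_pos.2 ha0, (Real.sq_sqrt ha0.le).symm⟩
    have hs : s ≤ 1 / 2 := by nlinarith
    have h1s : 0 < 1 - s := by linarith
    rw [Real.sqrt_sq hs0.le]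
    have hk := key (s / (1 - s)) (by positivity) (by rw [div_le_one h1s]; linarith)
    have e1 : s / (1 - s) * (1 + s / (1 - s)) = s / (1 - s) ^ 2 := by
      field_simp
      ring
    have e2 : (s ^ 2) ^ 2 + s ^ 2 * (1 - s ^ 2) * (s / (1 - s)) ^ 2 =
        2 * (s ^ 2) ^ 2 * (1 / s - 1) * (s / (1 - s) ^ 2) := by
      field_simp
      ring
    rw [e1, e2] at hk
    exact le_of_mul_le_mul_right hk (by positivity)
  · have hk := key 1 zero_le_one le_rfl
    have e : 2 * a ^ 2 * (1 / (4 * a)) = a / 2 := by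
      field_simp
      norm_num
    rw [e]
    linarith

lemma sum_cube_coord (n : ℕ) (i : Fin n) : ∑ x ∈ cube n, (x i : ℝ) = 0 := by
  have h : ∑ x ∈ cube n, (x i : ℝ) = ∑ x ∈ cube n, -(x i : ℝ) := by
    have hneg : ∀ x ∈ cube n, -x ∈ cube n := fun x hx => mem_cube.2 fun j => by
      rcases mem_cube.1 hx j with hj | hj <;> simp [hj]
    exact sum_nbij' (fun x => -x) (fun x => -x) hneg hneg (by simp) (by simp) (by simp)
  rw [sum_neg_distrib] at h
  linarith

lemma sum_cube_exp_le (n : ℕ) (l : Fin n → ℝ) :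
    ∑ x ∈ cube n, Real.exp (∑ i, l i * (x i : ℝ)) ≤
      2 ^ n * Real.exp ((∑ i, l i ^ 2) / 2) := by
  simp_rw [Real.exp_sum, cube]
  rw [← prod_univ_sum (fun _ => ({-1, 1} : Finset ℤ)) fun i b => Real.exp (l i * (b : ℝ)),
    sum_div, Real.exp_sum]
  have : (2 : ℝ) ^ n = ∏ _i : Fin n, 2 := by simp
  rw [this, ← prod_mul_distrib]
  refine prod_le_prod (fun i _ => by positivity) fun i _ => ?_
  rw [sum_pair (by norm_num)]
  have := Real.cosh_le_exp_half_sq (l i)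
  rw [Real.cosh_eq] at this
  push_cast
  rw [mul_neg_one, mul_one]
  linarith

/-- Young's inequality for the conjugate pair `u log u - u` and `exp`. -/
lemma mul_le_mul_log_sub_add_exp {u : ℝ} (hu : 0 < u) (v : ℝ) :
    u * v ≤ u * Real.log u - u + Real.exp v := by
  have h := Real.add_one_le_exp (v - Real.log u)
  rw [Real.exp_sub, Real.exp_log hu, le_div_iff₀ hu] at h
  linarith

/-- The level-one inequality `W₁(F) ≤ 2 E[F] Ent(F)` for the function `F` equal to `t` on
`f⁻¹(1)` and to `1` elsewhere. -/
lemma weightOne_mul_le_entropy (n : ℕ) (f : (Fin n → ℤ) → ℤ) (ha : density n f ≤ 1 / 2)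
    {t : ℝ} (ht : 0 < t) :
    weightOne n f * (t - 1) ^ 2 ≤ 2 * ((t * density n f + 1 - density n f) *
      (density n f * t * Real.log t - (t * density n f + 1 - density n f) *
        Real.log (t * density n f + 1 - density n f))) := by
  have ha0 : 0 ≤ density n f := by unfold density; positivity
  set a := density n f with ha_def
  set m := t * a + 1 - a with hm_def
  have hm : 0 < m := by nlinarith [mul_nonneg ht.le ha0]
  set l : Fin n → ℝ := fun i => (t - 1) * walshCoeff n f {i} / m with hl
  set κ := (∑ i, l i ^ 2) / 2 with hκ
  have hκ' : κ * (2 * m ^ 2) = weightOne n f * (t - 1) ^ 2 := by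
    simp only [hκ, hl, weightOne, div_pow, mul_pow]
    rw [← sum_div, ← mul_sum]
    field_simp
  set F : (Fin n → ℤ) → ℝ := fun x => if f x = 1 then t else 1 with hF
  have hFpos : ∀ x, 0 < F x := fun x => by
    simp only [hF]
    split_ifs <;> linarith
  have sum_F_mul : ∀ G : (Fin n → ℤ) → ℝ, ∑ x ∈ cube n, F x * G x =
      ∑ x ∈ cube n, G x + (t - 1) * ∑ x ∈ preimageOne n f, G x := by
    intro G
    rw [preimageOne, sum_filter, mul_sum, ← sum_add_distrib]
    refine sum_congr rfl fun x _ => ?_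
    simp only [hF]
    split_ifs <;> ring
  have sum_F : ∑ x ∈ cube n, F x = 2 ^ n * m := by
    have := sum_F_mul fun _ => 1
    simp only [mul_one, sum_const, nsmul_eq_mul, card_cube, card_preimageOne] at this
    rw [this, hm_def]
    ring
  have sum_F_log : ∑ x ∈ cube n, F x * Real.log (F x) = 2 ^ n * (a * t * Real.log t) := by
    have : ∀ x ∈ cube n, F x * Real.log (F x) = if f x = 1 then t * Real.log t else 0 := by
      intro x _
      simp only [hF]
      split_ifs <;> simp
    rw [sum_congr rfl this, ← sum_filter, sum_const, nsmul_eq_mul]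
    have := card_preimageOne n f
    rw [preimageOne] at this
    rw [this]
    ring
  have sum_F_lin : ∑ x ∈ cube n, F x * ∑ i, l i * (x i : ℝ) = 2 ^ n * (2 * κ * m) := by
    rw [sum_F_mul, sum_comm, sum_comm (s := preimageOne n f)]
    simp_rw [← mul_sum, sum_cube_coord]
    have : ∀ i, ∑ x ∈ preimageOne n f, (x i : ℝ) = 2 ^ n * walshCoeff n f {i} := by
      intro i
      simp only [walshCoeff, prod_singleton]
      field_simp
    simp_rw [this, mul_zero]
    rw [hκ, sum_const_zero, zero_add, mul_div_cancel₀ _ two_ne_zero, mul_sum, sum_mul,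
      mul_sum]
    refine sum_congr rfl fun i _ => ?_
    simp only [hl]
    field_simp
  have young := sum_le_sum fun x (_ : x ∈ cube n) =>
    mul_le_mul_log_sub_add_exp (hFpos x) (∑ i, l i * (x i : ℝ) + (Real.log m - κ))
  simp_rw [mul_add, Real.exp_add, sum_add_distrib, sum_sub_distrib, ← sum_mul] at young
  rw [sum_F, sum_F_log, sum_F_lin, Real.exp_sub, Real.exp_log hm] at young
  have hexp : (∑ x ∈ cube n, Real.exp (∑ i, l i * (x i : ℝ))) * (m / Real.exp κ) ≤ 2 ^ n * m := by
    calc _ ≤ 2 ^ n * Real.exp κ * (m / Real.exp κ) := by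
          gcongr
          exact sum_cube_exp_le n l
      _ = 2 ^ n * m := by field_simp
  have main : κ * m ≤ a * t * Real.log t - m * Real.log m := by
    have h2 : (0 : ℝ) < 2 ^ n := by positivity
    refine le_of_mul_le_mul_left ?_ h2
    linarith
  rw [← hκ']
  nlinarith [mul_le_mul_of_nonneg_left main hm.le]

lemma weightOne_le_psi (n : ℕ) (f : (Fin n → ℤ) → ℤ) (ha0 : 0 < density n f)
    (ha : density n f ≤ 1 / 2) :
    weightOne n f ≤ 2 * density n f ^ 2 * psi (density n f) := by
  have hpos : 0 < 2 * density n f ^ 2 := by positivity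
  rw [← div_le_iff₀' hpos, psi]
  refine le_csInf ⟨_, 2, by norm_num, by norm_num, rfl⟩ ?_
  rintro _ ⟨t, ht, ht1, rfl⟩
  have hsq : 0 < (t - 1) ^ 2 := sq_pos_of_ne_zero (sub_ne_zero.2 ht1)
  rw [div_le_div_iff₀ hpos (by positivity)]
  nlinarith [mul_le_mul_of_nonneg_left (weightOne_mul_le_entropy n f ha ht)
    (sq_nonneg (density n f))]

lemma weightOne_le_eta (n : ℕ) (f : (Fin n → ℤ) → ℤ) (ha0 : 0 < density n f)
    (ha : density n f ≤ 1 / 2) :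
    weightOne n f ≤ 2 * density n f ^ 2 * eta (density n f) := by
  rw [eta, mul_min_of_nonneg _ _ (by positivity)]
  exact le_min (weightOne_le_phi n f ha0) (weightOne_le_psi n f ha0 ha)

theorem noise_stability_bounds (n : ℕ) (f : (Fin n → ℤ) → ℤ)
    (hf : ∀ x ∈ cube n, f x = -1 ∨ f x = 1)
    (ha0 : 0 < density n f) (ha : density n f ≤ 1 / 2)
    (ρ : ℝ) (hρ0 : 0 ≤ ρ) (hρ1 : ρ ≤ 1) :
    max 0 ((density n f) ^ 2 - 2 * (density n f) ^ 2 * eta (density n f) * ρ -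
        (density n f * (1 - density n f) - 2 * (density n f) ^ 2 * eta (density n f)) * ρ ^ 2)
      ≤ qProb n f ρ ∧
    qProb n f ρ ≤
      min (density n f)
        ((density n f) ^ 2 + 2 * (density n f) ^ 2 * eta (density n f) * ρ +
        (density n f * (1 - density n f) - 2 * (density n f) ^ 2 * eta (density n f)) * ρ ^ 2) := by
  have hW := weightOne_le_eta n f ha0 ha
  have hW0 := weightOne_nonneg n f
  have habs : |ρ| ≤ 1 := by rwa [abs_of_nonneg hρ0]
  have hρ : 0 ≤ ρ - ρ ^ 2 := by nlinarith
  refine ⟨max_le (qProb_nonneg n f habs) ?_, le_min (qProb_le_density n f hρ0 hρ1) ?_⟩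
  · have h1 := mul_nonneg (hW0.trans hW) hρ
    have h2 : 0 ≤ density n f * (1 - density n f) * ρ ^ 2 :=
      mul_nonneg (mul_nonneg ha0.le (by linarith)) (sq_nonneg ρ)
    linarith [sq_density_le_qProb n f hρ0]
  · linarith [qProb_le n f habs, mul_le_mul_of_nonneg_right hW hρ]
end

section
/- Let i be a nonnegative integer and let β be a real number with 0 < β < 1/2. Then there exists a positive integer N such that for all n ≥ N, setting k := ⌊βn⌋, one has K_k^{(n)}(i) ≥ |K_k^{(n)}(x)| for every integer x with i ≤ x ≤ n−i. -/
open Polynomial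

/-- The coefficient of `z ^ k` in `(1 - z) ^ a * (1 + z) ^ b`. -/
noncomputable def krawCoeff (k a b : ℕ) : ℝ :=
  ((1 - X : ℝ[X]) ^ a * (1 + X) ^ b).coeff k

lemma genChoose_natCast_s14 (m j : ℕ) : genChoose (m : ℝ) j = m.choose j := by
  rw [genChoose, Nat.cast_choose_eq_descPochhammer_div, descPochhammer_eval_eq_prod_range]

lemma coeff_comp_neg_X (p : ℝ[X]) (j : ℕ) : (p.comp (-X)).coeff j = (-1) ^ j * p.coeff j := by
  have h : (-X : ℝ[X]) = C (-1) * X := by simp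
  rw [h, comp_C_mul_X_coeff, mul_comm]

lemma coeff_one_sub_X_pow (a j : ℕ) :
    ((1 - X : ℝ[X]) ^ a).coeff j = (-1) ^ j * (a.choose j : ℝ) := by
  rw [← coeff_one_add_X_pow, ← coeff_comp_neg_X]
  simp [sub_eq_add_neg]

lemma kraw_natCast {n x : ℕ} (k : ℕ) (hx : x ≤ n) : kraw n k x = krawCoeff k x (n - x) := by
  rw [krawCoeff, coeff_mul, Finset.Nat.sum_antidiagonal_eq_sum_range_succ_mk, kraw]
  refine Finset.sum_congr rfl fun j _ => ?_
  rw [← Nat.cast_sub hx, genChoose_natCast_s14, genChoose_natCast_s14, coeff_one_sub_X_pow,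
    coeff_one_add_X_pow]

lemma krawCoeff_swap (k a b : ℕ) : krawCoeff k b a = (-1) ^ k * krawCoeff k a b := by
  rw [krawCoeff, krawCoeff, ← coeff_comp_neg_X]
  simp [sub_eq_add_neg, mul_comm]

lemma krawCoeff_zero_left (k b : ℕ) : krawCoeff k 0 b = b.choose k := by
  simp [krawCoeff, coeff_one_add_X_pow]

lemma coeff_X_mul_derivative (p : ℝ[X]) (k : ℕ) : (X * derivative p).coeff k = k * p.coeff k := by
  cases k with
  | zero => simp
  | succ k => rw [coeff_X_mul, coeff_derivative]; push_cast; ring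

/-- The three-term recurrence of the Krawtchouk polynomials in the variable `a`. -/
lemma krawCoeff_recurrence (k a b : ℕ) :
    (b + 1 : ℝ) * krawCoeff k (a + 1) b =
      (a + b + 1 - 2 * k) * krawCoeff k a (b + 1) - a * krawCoeff k (a - 1) (b + 2) := by
  have key : C (b + 1 : ℝ) * ((1 - X : ℝ[X]) ^ (a + 1) * (1 + X) ^ b) =
      C (a + b + 1 : ℝ) * ((1 - X) ^ a * (1 + X) ^ (b + 1))
        - C 2 * (X * derivative ((1 - X) ^ a * (1 + X) ^ (b + 1)))
        - C (a : ℝ) * ((1 - X) ^ (a - 1) * (1 + X) ^ (b + 2)) := by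
    cases a with
    | zero =>
      simp only [derivative_mul, derivative_pow_succ, derivative_one, derivative_X, map_add, map_one,
        map_natCast, map_ofNat, pow_zero, Nat.cast_zero, map_zero]
      ring
    | succ a =>
      simp only [derivative_mul, derivative_pow_succ, derivative_one, derivative_X, derivative_sub,
        map_add, map_one, map_natCast, map_ofNat, Nat.cast_add, Nat.cast_one,
        Nat.add_sub_cancel]
      ring
  have h := congrArg (fun p => coeff p k) key
  simp only [coeff_sub, coeff_C_mul, coeff_X_mul_derivative] at h
  simp only [krawCoeff]
  linarith

lemma abs_coeff_mul_le {p p' q q' : ℝ[X]} (hp : ∀ j, |p.coeff j| ≤ p'.coeff j)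
    (hq : ∀ j, |q.coeff j| ≤ q'.coeff j) (j : ℕ) : |(p * q).coeff j| ≤ (p' * q').coeff j := by
  rw [coeff_mul, coeff_mul]
  refine (Finset.abs_sum_le_sum_abs _ _).trans (Finset.sum_le_sum fun s _ => ?_)
  rw [abs_mul]
  exact mul_le_mul (hp _) (hq _) (abs_nonneg _) ((abs_nonneg _).trans (hp _))

lemma abs_coeff_pow_le {p q : ℝ[X]} (h : ∀ j, |p.coeff j| ≤ q.coeff j) (m j : ℕ) :
    |(p ^ m).coeff j| ≤ (q ^ m).coeff j := by
  induction m generalizing j with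
  | zero => simp only [pow_zero, coeff_one]; split_ifs <;> simp
  | succ m ih => rw [pow_succ, pow_succ]; exact abs_coeff_mul_le ih h j

lemma coeff_mul_pow_le_eval {q : ℝ[X]} (hq : ∀ j, 0 ≤ q.coeff j) {r : ℝ} (hr : 0 ≤ r) (k : ℕ) :
    q.coeff k * r ^ k ≤ q.eval r := by
  have hnn : ∀ j, 0 ≤ q.coeff j * r ^ j := fun j => mul_nonneg (hq j) (pow_nonneg hr j)
  rw [eval_eq_sum_range]
  by_cases hk : k ≤ q.natDegree
  · exact Finset.single_le_sum (f := fun j => q.coeff j * r ^ j) (fun j _ => hnn j)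
      (Finset.mem_range.2 (Nat.lt_succ_of_le hk))
  · rw [coeff_eq_zero_of_natDegree_lt (not_le.1 hk), zero_mul]
    exact Finset.sum_nonneg fun j _ => hnn j

lemma abs_krawCoeff_mul_pow_le (k a d : ℕ) {r : ℝ} (hr : 0 ≤ r) :
    |krawCoeff k a (a + d)| * r ^ k ≤ (1 + r ^ 2) ^ a * (1 + r) ^ d := by
  have hsq : ∀ j, |(1 - X ^ 2 : ℝ[X]).coeff j| ≤ (1 + X ^ 2 : ℝ[X]).coeff j := by
    intro j
    rw [coeff_sub, coeff_add, coeff_one, coeff_X_pow]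
    split_ifs <;> simp_all
  have hlin : ∀ j, |(1 + X : ℝ[X]).coeff j| ≤ (1 + X : ℝ[X]).coeff j := by
    intro j
    rw [coeff_add, coeff_one, coeff_X]
    exact (abs_of_nonneg (by positivity)).le
  have hfac : (1 - X : ℝ[X]) ^ a * (1 + X) ^ (a + d) = (1 - X ^ 2) ^ a * (1 + X) ^ d := by
    rw [pow_add, ← mul_assoc, ← mul_pow]; congr 2; ring
  have hmaj := abs_coeff_mul_le (abs_coeff_pow_le hsq a) (abs_coeff_pow_le hlin d)
  have heval := coeff_mul_pow_le_eval (fun j => (abs_nonneg _).trans (hmaj j)) hr k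
  rw [krawCoeff, hfac]
  refine (mul_le_mul_of_nonneg_right (hmaj k) (pow_nonneg hr k)).trans ?_
  simpa using heval

/-- The terms `C(n,j) r ^ j` with `r = k / (n - k)` are largest at `j = k`. -/
lemma one_add_pow_le_choose_mul_pow {n k : ℕ} (hk : k < n) :
    (1 + (k / (n - k) : ℝ)) ^ n ≤ (n + 1) * (n.choose k * (k / (n - k) : ℝ) ^ k) := by
  have hpos : (0 : ℝ) < n - k := sub_pos.2 (by exact_mod_cast hk)
  set r : ℝ := k / (n - k) with hr
  have hr0 : 0 ≤ r := by positivity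
  have hrk : r * (n - k) = k := div_mul_cancel₀ _ hpos.ne'
  set T : ℕ → ℝ := fun j => n.choose j * r ^ j with hT
  have hT0 : ∀ j, 0 ≤ T j := fun j => by positivity
  have hstep : ∀ j, j ≤ n → (j + 1 : ℝ) * T (j + 1) = (n - j) * r * T j := by
    intro j hj
    have h : (n.choose (j + 1) : ℝ) * (j + 1) = n.choose j * (n - j) := by
      rw [← Nat.cast_sub hj]; exact_mod_cast Nat.choose_succ_right_eq n j
    simp only [hT, pow_succ]
    linear_combination r ^ j * r * h
  have hup : ∀ d, d ≤ k → T (k - d) ≤ T k := by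
    intro d
    induction d with
    | zero => intro; simp
    | succ d ih =>
      intro hd
      refine le_trans ?_ (ih (by omega))
      obtain ⟨j, hj⟩ : ∃ j, j + d + 1 = k := ⟨k - (d + 1), by omega⟩
      have e1 : k - (d + 1) = j := by omega
      have e2 : k - d = j + 1 := by omega
      rw [e1, e2]
      have hs := hstep j (by omega)
      have hjk : (j + 1 : ℝ) ≤ k := by exact_mod_cast (by omega : j + 1 ≤ k)
      have hge : (j + 1 : ℝ) ≤ (n - j) * r := by nlinarith
      have := mul_le_mul_of_nonneg_right hge (hT0 j)
      rw [← hs] at this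
      exact le_of_mul_le_mul_left this (by positivity)
  have hdown : ∀ d, k + d ≤ n → T (k + d) ≤ T k := by
    intro d
    induction d with
    | zero => intro; simp
    | succ d ih =>
      intro hd
      refine le_trans ?_ (ih (by omega))
      have hs := hstep (k + d) (by omega)
      push_cast at hs
      have hle : (n - (k + d)) * r ≤ (k + d + 1 : ℝ) := by
        have : (0 : ℝ) ≤ d := by positivity
        nlinarith [mul_nonneg this hr0]
      have := mul_le_mul_of_nonneg_right hle (hT0 (k + d))
      rw [← hs] at this
      exact le_of_mul_le_mul_left this (by positivity)
  have hmax : ∀ j ∈ Finset.range (n + 1), T j ≤ T k := by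
    intro j hj
    rw [Finset.mem_range] at hj
    rcases le_total j k with h | h
    · simpa [Nat.sub_sub_self h] using hup (k - j) (by omega)
    · simpa [Nat.add_sub_cancel' h] using hdown (j - k) (by omega)
  have hsum : (1 + r) ^ n = ∑ j ∈ Finset.range (n + 1), T j := by
    rw [add_comm, add_pow]
    exact Finset.sum_congr rfl fun j _ => by simp [hT, mul_comm]
  rw [hsum]
  simpa using Finset.sum_le_card_nsmul _ _ _ hmax

/-- Below a fixed index, consecutive values keep a ratio at least `c`. -/
lemma krawCoeff_ratio {n k i : ℕ} {c : ℝ} (hc : 0 < c) (hk : (2 * k : ℝ) ≤ (1 - 2 * c) * n)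
    (hi : (i : ℝ) ≤ c ^ 2 * n) (hin : i < n) :
    ∀ x ≤ i, c ^ x * n.choose k ≤ krawCoeff k x (n - x) ∧
      c * krawCoeff k x (n - x) ≤ krawCoeff k (x + 1) (n - (x + 1)) := by
  have hn : (0 : ℝ) < n := by exact_mod_cast (by omega : 0 < n)
  intro x
  induction x with
  | zero =>
    intro _
    obtain ⟨b, rfl⟩ : ∃ b, n = b + 1 := ⟨n - 1, by omega⟩
    refine ⟨by simp [krawCoeff_zero_left], ?_⟩
    have h := krawCoeff_recurrence k 0 b
    have h0 : 0 ≤ krawCoeff k 0 (b + 1) := by rw [krawCoeff_zero_left]; positivity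
    push_cast at h hk hn
    simp only [Nat.sub_zero, zero_add, Nat.add_sub_cancel] at h ⊢
    refine le_of_mul_le_mul_left ?_ hn
    rw [h]
    nlinarith [mul_nonneg hc.le hn.le]
  | succ x ih =>
    intro hx
    obtain ⟨h1, h2⟩ := ih (by omega)
    obtain ⟨b, rfl⟩ : ∃ b, n = x + b + 2 := ⟨n - x - 2, by omega⟩
    have e0 : x + b + 2 - x = b + 2 := by omega
    have e1 : x + b + 2 - (x + 1) = b + 1 := by omega
    have e2 : x + b + 2 - (x + 1 + 1) = b := by omega
    rw [e0, e1] at h2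
    rw [e0] at h1
    rw [e1, e2]
    have hlow : c ^ (x + 1) * (x + b + 2).choose k ≤ krawCoeff k (x + 1) (b + 1) := by
      refine le_trans ?_ h2
      rw [pow_succ', mul_assoc]
      exact mul_le_mul_of_nonneg_left h1 hc.le
    refine ⟨hlow, ?_⟩
    have h := krawCoeff_recurrence k (x + 1) b
    simp only [Nat.add_sub_cancel] at h
    have hxi : (x + 1 : ℝ) ≤ i := by exact_mod_cast hx
    push_cast at h hk hi hn
    set f0 := krawCoeff k x (b + 2)
    set f1 := krawCoeff k (x + 1) (b + 1)
    set f2 := krawCoeff k (x + 1 + 1) b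
    have hf1 : 0 ≤ f1 := le_trans (by positivity) hlow
    have hb : (0 : ℝ) < b + 1 := by positivity
    have hf0 : (x + 1) * f0 ≤ c * (x + b + 2) * f1 := by
      have hx0 : (0 : ℝ) ≤ x + 1 := by positivity
      refine le_of_mul_le_mul_left ?_ hc
      nlinarith [mul_le_mul_of_nonneg_left h2 hx0,
        mul_le_mul_of_nonneg_right (hxi.trans hi) hf1]
    refine le_of_mul_le_mul_left ?_ hb
    rw [h]
    have hx0 : (0 : ℝ) ≤ x + 1 := by positivity
    nlinarith [mul_le_mul_of_nonneg_right hk hf1, mul_nonneg (mul_nonneg hc.le hx0) hf1]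

lemma krawCoeff_succ_le {n k i : ℕ} (hin : i < n) (hik : i ≤ 2 * k)
    (h0 : 0 ≤ krawCoeff k (i - 1) (n - (i - 1))) (h1 : 0 ≤ krawCoeff k i (n - i)) :
    krawCoeff k (i + 1) (n - (i + 1)) ≤ krawCoeff k i (n - i) := by
  obtain ⟨b, rfl⟩ : ∃ b, n = i + b + 1 := ⟨n - i - 1, by omega⟩
  have e1 : i + b + 1 - i = b + 1 := by omega
  have e2 : i + b + 1 - (i + 1) = b := by omega
  rw [e1] at h1
  rw [e1, e2]
  have h := krawCoeff_recurrence k i b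
  have hprod : 0 ≤ (i : ℝ) * krawCoeff k (i - 1) (b + 2) := by
    rcases Nat.eq_zero_or_pos i with rfl | hi
    · simp
    · have e0 : i + b + 1 - (i - 1) = b + 2 := by omega
      rw [e0] at h0
      positivity
  have hik' : (i : ℝ) ≤ 2 * k := by exact_mod_cast hik
  refine le_of_mul_le_mul_left ?_ (by positivity : (0 : ℝ) < b + 1)
  rw [h]
  nlinarith [mul_le_mul_of_nonneg_right hik' h1]

lemma abs_krawCoeff_le_of_le {n k i : ℕ} {M : ℝ} (hkn : 2 * k < n)
    (h0 : |krawCoeff k i (n - i)| ≤ M) (h1 : |krawCoeff k (i + 1) (n - (i + 1))| ≤ M)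
    {x : ℕ} (hix : i ≤ x) (hxk : x ≤ k) :
    |krawCoeff k x (n - x)| ≤ M ∧ |krawCoeff k (x + 1) (n - (x + 1))| ≤ M := by
  induction x, hix using Nat.le_induction with
  | base => exact ⟨h0, h1⟩
  | succ x hix ih =>
    obtain ⟨g0, g1⟩ := ih (by omega)
    refine ⟨g1, ?_⟩
    obtain ⟨b, rfl⟩ : ∃ b, n = x + b + 2 := ⟨n - x - 2, by omega⟩
    have e0 : x + b + 2 - x = b + 2 := by omega
    have e1 : x + b + 2 - (x + 1) = b + 1 := by omega
    have e2 : x + b + 2 - (x + 1 + 1) = b := by omega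
    rw [e0] at g0
    rw [e1] at g1
    rw [e2]
    have h := krawCoeff_recurrence k (x + 1) b
    simp only [Nat.add_sub_cancel] at h
    push_cast at h
    have hb : (0 : ℝ) < b + 1 := by positivity
    have hx0 : (0 : ℝ) ≤ x + 1 := by positivity
    have hd : (0 : ℝ) ≤ x + 1 + b + 1 - 2 * k := by
      have : (2 * k : ℝ) < x + b + 2 := by exact_mod_cast hkn
      linarith
    have hxk' : (x + 1 : ℝ) ≤ k := by exact_mod_cast hxk
    have hM : 0 ≤ M := (abs_nonneg _).trans g0
    refine le_of_mul_le_mul_left ?_ hb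
    calc (b + 1 : ℝ) * |krawCoeff k (x + 1 + 1) b|
        = |(b + 1 : ℝ) * krawCoeff k (x + 1 + 1) b| := by rw [abs_mul, abs_of_pos hb]
      _ ≤ (x + 1 + b + 1 - 2 * k) * |krawCoeff k (x + 1) (b + 1)|
            + (x + 1) * |krawCoeff k x (b + 2)| := by
          rw [h]
          refine (abs_sub _ _).trans ?_
          rw [abs_mul, abs_mul, abs_of_nonneg hd, abs_of_nonneg hx0]
      _ ≤ (x + 1 + b + 1 - 2 * k) * M + (x + 1) * M := by gcongr
      _ ≤ (b + 1) * M := by nlinarith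

lemma abs_krawCoeff_le_exp {n k x : ℕ} {δ : ℝ} (hδ0 : 0 ≤ δ) (hδ1 : δ ≤ 1) (hkn : 2 * k < n)
    (hδ : δ * n ≤ k) (hkx : k ≤ x) (hxn : 2 * x ≤ n) :
    |krawCoeff k x (n - x)| ≤ (n + 1) * (1 - δ) ^ k * n.choose k := by
  have hkn' : (2 * k : ℝ) < n := by exact_mod_cast hkn
  have hk0 : (0 : ℝ) ≤ k := Nat.cast_nonneg k
  have hpos : (0 : ℝ) < n - k := by linarith
  have hchoose := one_add_pow_le_choose_mul_pow (show k < n by omega)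
  set r : ℝ := k / (n - k) with hr
  have hr0 : 0 ≤ r := by positivity
  have hrk : 0 < r ^ k := by
    rcases Nat.eq_zero_or_pos k with rfl | hk
    · simp
    · have : (0 : ℝ) < k := by exact_mod_cast hk
      positivity
  have hratio : 1 + r ^ 2 ≤ (1 - δ) * (1 + r) ^ 2 := by
    have hδr : δ * (1 + r) ^ 2 ≤ 2 * r := by
      have h1 : 1 + r = n / (n - k) := by rw [hr]; field_simp; ring
      rw [h1, hr, div_pow, ← mul_div_assoc, ← mul_div_assoc, div_le_div_iff₀ (by positivity) hpos]
      have h2 : δ * n ^ 2 ≤ 2 * k * (n - k) := by nlinarith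
      nlinarith [mul_le_mul_of_nonneg_right h2 hpos.le]
    nlinarith
  obtain ⟨d, rfl⟩ : ∃ d, n = 2 * x + d := ⟨n - 2 * x, by omega⟩
  have e : 2 * x + d - x = x + d := by omega
  rw [e]
  refine le_of_mul_le_mul_right ?_ hrk
  have hδ' : 0 ≤ 1 - δ := by linarith
  calc |krawCoeff k x (x + d)| * r ^ k ≤ (1 + r ^ 2) ^ x * (1 + r) ^ d :=
        abs_krawCoeff_mul_pow_le k x d hr0
    _ ≤ ((1 - δ) * (1 + r) ^ 2) ^ x * (1 + r) ^ d := by gcongr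
    _ = (1 - δ) ^ x * (1 + r) ^ (2 * x + d) := by rw [mul_pow, ← pow_mul, pow_add]; ring
    _ ≤ (1 - δ) ^ k * (((2 * x + d : ℕ) + 1) * ((2 * x + d).choose k * r ^ k)) :=
        mul_le_mul (pow_le_pow_of_le_one hδ' (by linarith) hkx) hchoose (by positivity)
          (by positivity)
    _ = _ := by ring

lemma eventually_mul_pow_floor_le {β c : ℝ} (hβ0 : 0 < β) (hβ : β < 1 / 2) (hc : 0 < c) :
    ∀ᶠ n : ℕ in Filter.atTop, (n + 1 : ℝ) * (1 - β / 2) ^ ⌊β * n⌋₊ ≤ c := by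
  have hq0 : 0 ≤ 1 - β / 2 := by linarith
  have hq1 : 1 - β / 2 < 1 := by linarith
  have hlim : Filter.Tendsto (fun m : ℕ => ((2 * β⁻¹) * (m * (1 - β / 2) ^ m)
      + (β⁻¹ + 1) * (1 - β / 2) ^ m : ℝ)) Filter.atTop (nhds 0) := by
    simpa using ((tendsto_self_mul_const_pow_of_lt_one hq0 hq1).const_mul (2 * β⁻¹)).add
      ((tendsto_pow_atTop_nhds_zero_of_lt_one hq0 hq1).const_mul (β⁻¹ + 1))
  have hfloor : Filter.Tendsto (fun n : ℕ => ⌊β * n⌋₊) Filter.atTop Filter.atTop :=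
    tendsto_nat_floor_atTop.comp (tendsto_natCast_atTop_atTop.const_mul_atTop hβ0)
  filter_upwards [(hlim.comp hfloor).eventually_le_const hc] with n hn
  refine le_trans ?_ hn
  have hk := Nat.lt_floor_add_one (β * n)
  simp only [Function.comp_apply]
  set k := ⌊β * n⌋₊
  have hn' : (n : ℝ) ≤ β⁻¹ * (k + 1) := by
    rw [inv_mul_eq_div, le_div_iff₀ hβ0]; linarith
  have hnk : (n + 1 : ℝ) ≤ 2 * β⁻¹ * k + (β⁻¹ + 1) := by
    have : 0 ≤ β⁻¹ * k := by positivity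
    linarith
  calc (n + 1 : ℝ) * (1 - β / 2) ^ k ≤ (2 * β⁻¹ * k + (β⁻¹ + 1)) * (1 - β / 2) ^ k := by gcongr
    _ = _ := by ring

/-- A sufficient list of inequalities for the extremality of the value at `i`. -/
lemma abs_krawCoeff_le_of_two_mul_le {n k i x : ℕ} {c δ : ℝ} (hc : 0 < c)
    (hk : (2 * k : ℝ) ≤ (1 - 2 * c) * n) (hi : (i : ℝ) ≤ c ^ 2 * n) (hik : i ≤ k)
    (hkn : 2 * k < n) (hδ0 : 0 ≤ δ) (hδ1 : δ ≤ 1) (hδ : δ * n ≤ k)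
    (hexp : (n + 1 : ℝ) * (1 - δ) ^ k ≤ c ^ i) (hix : i ≤ x) (hxn : 2 * x ≤ n) :
    |krawCoeff k x (n - x)| ≤ krawCoeff k i (n - i) := by
  have hratio := krawCoeff_ratio hc hk hi (by omega)
  have hnonneg : ∀ y ≤ i, 0 ≤ krawCoeff k y (n - y) := fun y hy =>
    le_trans (by positivity) (hratio y hy).1
  rcases le_total x k with hxk | hkx
  · have hsucc0 : 0 ≤ krawCoeff k (i + 1) (n - (i + 1)) :=
      (mul_nonneg hc.le (hnonneg i le_rfl)).trans (hratio i le_rfl).2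
    refine (abs_krawCoeff_le_of_le hkn (abs_of_nonneg (hnonneg i le_rfl)).le ?_ hix hxk).1
    rw [abs_of_nonneg hsucc0]
    exact krawCoeff_succ_le (by omega) (by omega) (hnonneg _ (Nat.sub_le i 1)) (hnonneg i le_rfl)
  · calc |krawCoeff k x (n - x)| ≤ (n + 1) * (1 - δ) ^ k * n.choose k :=
          abs_krawCoeff_le_exp hδ0 hδ1 hkn hδ hkx hxn
      _ ≤ c ^ i * n.choose k := by gcongr
      _ ≤ krawCoeff k i (n - i) := (hratio i le_rfl).1

theorem kraw_max_at_i (i : ℕ) (β : ℝ) (hβ0 : 0 < β) (hβ : β < 1 / 2) :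
    ∃ N : ℕ, 0 < N ∧ ∀ n : ℕ, N ≤ n →
      ∀ x : ℕ, i ≤ x → x + i ≤ n →
        |kraw n ⌊β * n⌋₊ (x : ℝ)| ≤ kraw n ⌊β * n⌋₊ (i : ℝ) := by
  have hc : 0 < 1 / 2 - β := by linarith
  have hlarge : ∀ a b : ℝ, 0 < a → ∀ᶠ n : ℕ in Filter.atTop, b ≤ a * n := fun a b ha =>
    (tendsto_natCast_atTop_atTop.const_mul_atTop ha).eventually_ge_atTop b
  have hev := (hlarge _ i (pow_pos hc 2)).and <| (hlarge β i hβ0).and <| (hlarge β 2 hβ0).and <|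
    eventually_mul_pow_floor_le hβ0 hβ (pow_pos hc i)
  obtain ⟨N, hN⟩ := Filter.eventually_atTop.1 hev
  refine ⟨N + 1, N.succ_pos, fun n hn x hix hxn => ?_⟩
  obtain ⟨hi, hik, hβ2, hexp⟩ := hN n (by omega)
  have hn0 : (0 : ℝ) < n := by exact_mod_cast (by omega : 0 < n)
  have hfl := Nat.floor_le (mul_nonneg hβ0.le hn0.le)
  have hlt := Nat.lt_floor_add_one (β * n)
  replace hik : i ≤ ⌊β * n⌋₊ := Nat.le_floor hik
  set k := ⌊β * n⌋₊
  have hkn : 2 * k < n := by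
    have : (2 * k : ℝ) < n := by nlinarith
    exact_mod_cast this
  have main : ∀ y, i ≤ y → 2 * y ≤ n → |krawCoeff k y (n - y)| ≤ krawCoeff k i (n - i) :=
    fun y => abs_krawCoeff_le_of_two_mul_le hc (by linarith) hi hik hkn (by linarith)
      (by linarith) (by linarith) hexp
  rw [kraw_natCast k (by omega : x ≤ n), kraw_natCast k (by omega : i ≤ n)]
  rcases le_total (2 * x) n with h | h
  · exact main x hix h
  · have hrefl := main (n - x) (by omega) (by omega)
    rwa [Nat.sub_sub_self (by omega : x ≤ n), krawCoeff_swap, abs_mul, abs_pow, abs_neg, abs_one,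
      one_pow, one_mul] at hrefl
end
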